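/- Wick's theorem for Heisenberg monomials: if M = m_1 ⋯ m_l is a monomial where each factor is of the form a_{-μ} a_ν (μ, ν partitions), b_{-k} b_k, or b_{-k} (k > 0), then ⟨M⟩ = ∑_{[Γ]} mult(Γ, y), the sum over equivalence classes of Feynman diagrams for M, where mult(Γ,y) = ∏_{edges e} [w(e)]_y. -/

import Mathlib

open Finset
open scoped Classical

/-- The ground ring ℚ[y^{±1/2}], realized as Laurent polynomials in q = y^{1/2}. -/
abbrev RR : Type := LaurentPolynomial ℚ

/-- The quantum integer [n]_y = q^{n-1} + q^{n-3} + ... + q^{-(n-1)} for n : ℕ. -/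
noncomputable def Qnat (n : ℕ) : RR :=
  ∑ j ∈ Finset.range n, LaurentPolynomial.T ((n : ℤ) - 1 - 2 * (j : ℤ))

/-- The quantum integer [n]_y for n : ℤ (odd extension: [-n] = -[n], [0] = 0). -/
noncomputable def qInt (n : ℤ) : RR :=
  if 0 ≤ n then Qnat n.toNat else - Qnat (-n).toNat

/-- Ordered product ∏_i (g i)^(μ i) over the parts of a partition
μ = (1^{μ 1}, 2^{μ 2}, ...). -/
noncomputable def prodOp {M : Type*} [Monoid M] (g : ℕ → M) (μ : ℕ →₀ ℕ) : M :=
  ((List.range (μ.support.sup id + 1)).map (fun i => g i ^ μ i)).prod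

/-- μ! = ∏_i (μ i)!. -/
noncomputable def factQ (μ : ℕ →₀ ℕ) : ℚ := μ.prod fun _ k => (Nat.factorial k : ℚ)

/-- ‖μ‖ = ∑ i · μ i, the number partitioned by μ. -/
def normI (μ : ℕ →₀ ℕ) : ℕ := μ.sum fun i k => i * k

variable {F : Type*} [AddCommGroup F] [Module RR F]

/-- The Fock space basis vector v_{μ,ν} = a_{-μ} b_{-ν} v_∅, where
a_{-μ} = ∏_i a_{-i}^{μ i}/μ_i! and b_{-ν} = ∏_j b_{-j}^{ν j}/ν_j!. -/
noncomputable def vvec (a b : ℤ → Module.End RR F) (vac : F) (μ ν : ℕ →₀ ℕ) : F :=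
  (LaurentPolynomial.C ((factQ μ * factQ ν)⁻¹)) •
    ((prodOp (fun i => a (-(i : ℤ))) μ * prodOp (fun i => b (-(i : ℤ))) ν) vac)

/-- a_{-μ} = ∏_i a_{-i}^{μ_i}/μ_i!. -/
noncomputable def aNegF (a : ℤ → Module.End RR F) (μ : ℕ →₀ ℕ) : Module.End RR F :=
  (LaurentPolynomial.C (factQ μ)⁻¹) • prodOp (fun i => a (-(i : ℤ))) μ

/-- a_ν = ∏_i a_i^{ν_i}/ν_i!. -/
noncomputable def aPosF (a : ℤ → Module.End RR F) (ν : ℕ →₀ ℕ) : Module.End RR F :=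
  (LaurentPolynomial.C (factQ ν)⁻¹) • prodOp (fun i => a (i : ℤ)) ν

/-- A factor of a Heisenberg monomial M = m_0 ⋯ m_l: either a_{-μ} a_ν
(`inl (μ,ν)`), or b_{-k} b_k (`inr (k, true)`), or b_{-k} (`inr (k, false)`). -/
abbrev FacW : Type := ((ℕ →₀ ℕ) × (ℕ →₀ ℕ)) ⊕ (ℕ × Bool)

/-- Interpret a factor as an operator. -/
noncomputable def toOpW (a b : ℤ → Module.End RR F) : FacW → Module.End RR F
  | .inl (μ, ν) => aNegF a μ * aPosF a ν
  | .inr (k, true) => b (-(k : ℤ)) * b (k : ℤ)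
  | .inr (k, false) => b (-(k : ℤ))

/-- Valid factors: partitions with no 0 parts, and k > 0. -/
def ValidFacW : FacW → Prop
  | .inl (μ, ν) => μ 0 = 0 ∧ ν 0 = 0
  | .inr (k, _) => 0 < k

/-- The factor at position i of the word (vertices of the Feynman diagram). -/
def facAt (L : List FacW) (i : ℕ) : FacW := L.getD i (Sum.inr (1, false))

/-- Number of outgoing edges of weight k at vertex i, for an edge-multiplicity
function g : (i,j,k) ↦ number of edges i → j of weight k. -/
def outDeg (L : List FacW) (g : ℕ × ℕ × ℕ → ℕ) (i k : ℕ) : ℕ :=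
  ∑ j ∈ Finset.range L.length, g (i, j, k)

/-- Number of incoming edges of weight k at vertex i. -/
def inDeg (L : List FacW) (g : ℕ × ℕ × ℕ → ℕ) (i k : ℕ) : ℕ :=
  ∑ j ∈ Finset.range L.length, g (j, i, k)

/-- A Feynman diagram (equivalence class) for the monomial encoded by L:
an equivalence class of Feynman diagrams is exactly given by the function g
counting, for i < j and weight k > 0, the edges i → j of weight k.  Edges join
vertices of different colors (white = a-factors, black = b-factors); a vertex
with factor a_{-μ}a_ν has μ_k incoming and ν_k outgoing edges of weight k; a
vertex b_{-k}b_k has one incoming and one outgoing edge of weight k; a vertex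
b_{-k} has one incoming edge of weight k and no outgoing edges. -/
def IsFeynman (L : List FacW) (g : ℕ × ℕ × ℕ → ℕ) : Prop :=
  (∀ i j k, g (i, j, k) ≠ 0 →
      i < j ∧ j < L.length ∧ 0 < k ∧ (facAt L i).isLeft ≠ (facAt L j).isLeft) ∧
  (∀ i < L.length, ∀ μ ν, facAt L i = Sum.inl (μ, ν) →
      ∀ k, outDeg L g i k = ν k ∧ inDeg L g i k = μ k) ∧
  (∀ i < L.length, ∀ k₀ : ℕ, facAt L i = Sum.inr (k₀, true) →
      ∀ k, (outDeg L g i k = if k = k₀ then 1 else 0) ∧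
           (inDeg L g i k = if k = k₀ then 1 else 0)) ∧
  (∀ i < L.length, ∀ k₀ : ℕ, facAt L i = Sum.inr (k₀, false) →
      ∀ k, outDeg L g i k = 0 ∧ (inDeg L g i k = if k = k₀ then 1 else 0))

/-- mult(Γ,y) = ∏_{edges e} [w(e)]_y. -/
noncomputable def multW (g : ℕ × ℕ × ℕ → ℕ) : RR :=
  ∏ᶠ p : ℕ × ℕ × ℕ, Qnat p.2.2 ^ g p

theorem natCast_smul_cancel {M : Type*} [AddCommGroup M] [Module RR M] (m : ℕ) {x y : M}
    (h : ((m + 1 : ℕ) : RR) • x = ((m + 1 : ℕ) : RR) • y) : x = y := by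
  have hc : LaurentPolynomial.C ((m + 1 : ℕ) : ℚ)⁻¹ * ((m + 1 : ℕ) : RR) = 1 := by
    rw [← map_natCast (LaurentPolynomial.C (R := ℚ)), ← map_mul,
      inv_mul_cancel₀ (by positivity), map_one]
  have h' := congrArg (fun z => LaurentPolynomial.C ((m + 1 : ℕ) : ℚ)⁻¹ • z) h
  simpa only [smul_smul, hc, one_smul] using h'

theorem prodOp_eq_of_support_subset {M : Type*} [Monoid M] (g : ℕ → M) (μ : ℕ →₀ ℕ) (N : ℕ)
    (hN : ∀ i ∈ μ.support, i < N) :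
    prodOp g μ = ((List.range N).map (fun i => g i ^ μ i)).prod := by
  have key : ∀ n d : ℕ, (∀ i ∈ μ.support, i < n) →
      ((List.range (n + d)).map (fun i => g i ^ μ i)).prod
        = ((List.range n).map (fun i => g i ^ μ i)).prod := by
    intro n d hn
    induction d with
    | zero => rfl
    | succ d ih =>
      have h0 : μ (n + d) = 0 := by
        by_contra h
        have := hn _ (Finsupp.mem_support_iff.2 h)
        omega
      rw [← add_assoc, List.range_succ, List.map_append, List.prod_append, ih]
      simp [h0]
  have hsup : ∀ i ∈ μ.support, i < μ.support.sup id + 1 := fun i hi =>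
    Nat.lt_succ_of_le (Finset.le_sup (f := id) hi)
  unfold prodOp
  rw [← key _ N hsup, ← key N (μ.support.sup id + 1) hN, add_comm]

theorem prodOp_add_single {M : Type*} [Monoid M] (g : ℕ → M)
    (hg : ∀ i j, Commute (g i) (g j)) (μ : ℕ →₀ ℕ) (k : ℕ) :
    prodOp g (μ + Finsupp.single k 1) = prodOp g μ * g k := by
  have key : ∀ l : List ℕ, l.Nodup →
      (l.map (fun i => g i ^ (μ + Finsupp.single k 1 : ℕ →₀ ℕ) i)).prod
        = (l.map (fun i => g i ^ μ i)).prod * (if k ∈ l then g k else 1) := by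
    intro l
    induction l with
    | nil => simp
    | cons h t ih =>
      intro hl
      rw [List.nodup_cons] at hl
      rw [List.map_cons, List.prod_cons, ih hl.2, List.map_cons, List.prod_cons]
      by_cases hk : k = h
      · subst hk
        have hcomm : Commute (g k) ((t.map (fun i => g i ^ μ i)).prod) := by
          refine Commute.list_prod_right _ _ fun x hx => ?_
          obtain ⟨i, -, rfl⟩ := List.mem_map.1 hx
          exact (hg k i).pow_right _
        simp [hl.1, pow_succ, mul_assoc, hcomm.eq]
      · simp [hk, mul_assoc]
  obtain ⟨N, hN⟩ : ∃ N, ∀ i ∈ insert k (μ.support ∪ (μ + Finsupp.single k 1).support), i < N :=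
    ⟨_, fun i hi => Nat.lt_succ_of_le (Finset.le_sup (f := id) hi)⟩
  rw [prodOp_eq_of_support_subset g _ N fun i hi =>
      hN i (by simp only [mem_insert, mem_union, hi, or_true]),
    prodOp_eq_of_support_subset g μ N fun i hi =>
      hN i (by simp only [mem_insert, mem_union, hi, or_true, true_or]),
    key _ List.nodup_range, if_pos (List.mem_range.2 (hN k (by simp)))]

theorem factQ_add_single (μ : ℕ →₀ ℕ) (k : ℕ) :
    factQ (μ + Finsupp.single k 1) = ((μ k + 1 : ℕ) : ℚ) * factQ μ := by
  have h1 : factQ μ = ∏ i ∈ insert k μ.support, ((μ i).factorial : ℚ) :=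
    Finsupp.prod_of_support_subset _ (Finset.subset_insert _ _) _ (by simp)
  have h2 : factQ (μ + Finsupp.single k 1)
      = ∏ i ∈ insert k μ.support, (((μ + Finsupp.single k 1 : ℕ →₀ ℕ) i).factorial : ℚ) := by
    refine Finsupp.prod_of_support_subset _ ?_ _ (by simp)
    intro i hi
    by_cases h : i = k
    · simp [h]
    · have : ¬ k = i := fun h' => h h'.symm
      simpa [h, this, Finsupp.single_apply] using hi
  have hk : k ∈ insert k μ.support := Finset.mem_insert_self _ _
  rw [h1, h2, ← Finset.mul_prod_erase _ _ hk, ← Finset.mul_prod_erase _ _ hk, ← mul_assoc]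
  congr 1
  · simp [Nat.factorial_succ]
  · refine Finset.prod_congr rfl fun i hi => ?_
    have : ¬ k = i := fun h' => (Finset.ne_of_mem_erase hi) h'.symm
    simp [this]

/-- The divided power monomial `∏_i y_i ^ μ_i / μ_i!`. -/
noncomputable def divPow (y : ℕ → Module.End RR F) (μ : ℕ →₀ ℕ) : Module.End RR F :=
  (LaurentPolynomial.C (factQ μ)⁻¹) • prodOp y μ

theorem divPow_zero (y : ℕ → Module.End RR F) : divPow y 0 = 1 := by
  simp [divPow, factQ, prodOp]

theorem divPow_add_single (y : ℕ → Module.End RR F) (hy : ∀ i j, Commute (y i) (y j))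
    (μ : ℕ →₀ ℕ) (k : ℕ) :
    ((μ k + 1 : ℕ) : RR) • divPow y (μ + Finsupp.single k 1) = divPow y μ * y k := by
  have hc : ((μ k + 1 : ℕ) : RR) * LaurentPolynomial.C (factQ (μ + Finsupp.single k 1))⁻¹
      = LaurentPolynomial.C (factQ μ)⁻¹ := by
    rw [← map_natCast (LaurentPolynomial.C (R := ℚ)), ← map_mul, factQ_add_single, mul_inv,
      mul_inv_cancel_left₀ (by positivity)]
  rw [divPow, divPow, smul_smul, hc, prodOp_add_single y hy, smul_mul_assoc]

theorem divPow_single_one (y : ℕ → Module.End RR F) (hy : ∀ i j, Commute (y i) (y j)) (k : ℕ) :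
    divPow y (Finsupp.single k 1) = y k := by
  simpa [divPow_zero] using divPow_add_single y hy 0 k

theorem partition_induction {α : Type*} {P : (α →₀ ℕ) → Prop} (zero : P 0)
    (add_single : ∀ μ k, P μ → P (μ + Finsupp.single k 1)) (μ : α →₀ ℕ) : P μ := by
  induction μ using Finsupp.induction with
  | zero => exact zero
  | single_add k n f _ _ ih =>
    clear * - ih add_single
    rw [add_comm]
    induction n with
    | zero => simpa using ih
    | succ n ihn => rw [Finsupp.single_add, ← add_assoc]; exact add_single _ _ ihn

/-- Commuting an operator past a divided power monomial. -/
theorem mul_divPow (D : Module.End RR F) (y : ℕ → Module.End RR F) (k : ℕ) (w : RR)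
    (hy : ∀ i j, Commute (y i) (y j))
    (hD : ∀ l, D * y l = y l * D + if k = l then w • (1 : Module.End RR F) else 0)
    (μ : ℕ →₀ ℕ) :
    D * divPow y μ = divPow y μ * D
      + if 0 < μ k then w • divPow y (μ - Finsupp.single k 1) else 0 := by
  induction μ using partition_induction with
  | zero => simp [divPow_zero]
  | add_single μ l ih =>
    apply natCast_smul_cancel (μ l)
    rw [← mul_smul_comm, divPow_add_single y hy, ← mul_assoc, ih, add_mul, mul_assoc, hD, mul_add,
      smul_add, ← smul_mul_assoc, divPow_add_single y hy, mul_assoc, add_assoc]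
    congr 1
    by_cases hkl : k = l
    · subst hkl
      simp only [if_true, Finsupp.add_apply, Finsupp.single_eq_same, Nat.succ_pos,
        add_tsub_cancel_right, mul_smul_comm, mul_one, Nat.cast_add, Nat.cast_one]
      by_cases hμ : 0 < μ k
      · have hsub : μ - Finsupp.single k 1 + Finsupp.single k 1 = μ :=
          tsub_add_cancel_of_le (Finsupp.single_le_iff.2 hμ)
        have h := divPow_add_single y hy (μ - Finsupp.single k 1) k
        rw [hsub] at h
        have hk : (μ - Finsupp.single k 1 : ℕ →₀ ℕ) k + 1 = μ k := by simp; omega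
        rw [hk] at h
        rw [if_pos hμ, smul_mul_assoc, ← h, add_smul, one_smul, smul_comm, add_comm]
      · have : μ k = 0 := by omega
        simp [this]
    · have hlk : ¬ l = k := fun h => hkl h.symm
      simp only [if_neg hkl, mul_zero, add_zero, Finsupp.add_apply, Finsupp.single_apply,
        if_neg hlk]
      by_cases hμ : 0 < μ k
      · have hsub : μ + Finsupp.single l 1 - Finsupp.single k 1
            = μ - Finsupp.single k 1 + Finsupp.single l 1 :=
          (tsub_add_eq_add_tsub (Finsupp.single_le_iff.2 hμ)).symm
        have h := divPow_add_single y hy (μ - Finsupp.single k 1) l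
        have hk : (μ - Finsupp.single k 1 : ℕ →₀ ℕ) l = μ l := by simp [hkl]
        rw [hk] at h
        rw [if_pos hμ, if_pos hμ, hsub, smul_comm, h, smul_mul_assoc, zero_add]
      · simp [hμ]

/-- Two colors of creation operators `u` and annihilation operators `d` satisfying the Heisenberg
relations, acting on a vacuum `vac`, together with a functional `ev` computing vacuum
expectations. -/
structure IsWickSystem (u d : Bool → ℕ → Module.End RR F) (vac : F) (ev : F →ₗ[RR] RR) : Prop where
  comm_up : ∀ c k l, Commute (u c k) (u c l)
  comm_down : ∀ c c' k l, Commute (d c k) (d c' l)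
  down_mul_up : ∀ c c' k l, d c k * u c' l
    = u c' l * d c k + if c ≠ c' ∧ k = l then Qnat k • (1 : Module.End RR F) else 0
  down_vac : ∀ c k, d c k vac = 0
  ev_up : ∀ c k x, ev (u c k x) = 0
  ev_vac : ev vac = 1

section Wick

variable {V : Type*} (u d : Bool → ℕ → Module.End RR F) (c : V → Bool)

/-- The normally ordered operator at the vertex `j`. -/
noncomputable def vertexOp (p q : V × ℕ →₀ ℕ) (j : V) : Module.End RR F :=
  divPow (u (c j)) (p.curry j) * divPow (d (c j)) (q.curry j)

/-- The product of the vertex operators along a list of vertices. -/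
noncomputable def vertexProd (l : List V) (p q : V × ℕ →₀ ℕ) : Module.End RR F :=
  (l.map (vertexOp u d c p q)).prod

theorem curry_add_single_self (q : V × ℕ →₀ ℕ) (i : V) (k : ℕ) :
    (q + Finsupp.single (i, k) 1).curry i = q.curry i + Finsupp.single k 1 := by
  ext m
  simp [Finsupp.single_apply]

theorem curry_add_single_ne (q : V × ℕ →₀ ℕ) {i j : V} (h : i ≠ j) (k : ℕ) :
    (q + Finsupp.single (i, k) 1).curry j = q.curry j := by
  ext m
  simp [h]

theorem curry_sub_single_self (q : V × ℕ →₀ ℕ) (i : V) (k : ℕ) :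
    (q - Finsupp.single (i, k) 1).curry i = q.curry i - Finsupp.single k 1 := by
  ext m
  simp [Finsupp.single_apply]

theorem curry_sub_single_ne (q : V × ℕ →₀ ℕ) {i j : V} (h : i ≠ j) (k : ℕ) :
    (q - Finsupp.single (i, k) 1).curry j = q.curry j := by
  ext m
  simp [h]

variable {u d c}

theorem vertexProd_cons (h : V) (t : List V) (p q : V × ℕ →₀ ℕ) :
    vertexProd u d c (h :: t) p q = vertexOp u d c p q h * vertexProd u d c t p q := by
  simp [vertexProd]

theorem vertexProd_sub_single {t : List V} {h : V} (ht : h ∉ t) (p q : V × ℕ →₀ ℕ) (k : ℕ) :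
    vertexProd u d c t (p - Finsupp.single (h, k) 1) q = vertexProd u d c t p q := by
  unfold vertexProd
  congr 1
  refine List.map_congr_left fun j hj => ?_
  have hjh : h ≠ j := fun e => ht (e ▸ hj)
  rw [vertexOp, vertexOp, curry_sub_single_ne _ hjh]

theorem vertexProd_add_single {t : List V} {h : V} (ht : h ∉ t) (p q : V × ℕ →₀ ℕ) (k : ℕ) :
    vertexProd u d c t p (q + Finsupp.single (h, k) 1) = vertexProd u d c t p q := by
  unfold vertexProd
  congr 1
  refine List.map_congr_left fun j hj => ?_
  have hjh : h ≠ j := fun e => ht (e ▸ hj)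
  rw [vertexOp, vertexOp, curry_add_single_ne _ hjh]

variable {vac : F} {ev : F →ₗ[RR] RR}

theorem IsWickSystem.down_mul_vertexOp (H : IsWickSystem u d vac ev) (b : Bool) (k : ℕ)
    (p q : V × ℕ →₀ ℕ) (j : V) :
    d b k * vertexOp u d c p q j = vertexOp u d c p q j * d b k
      + if b ≠ c j ∧ 0 < p (j, k)
        then Qnat k • vertexOp u d c (p - Finsupp.single (j, k) 1) q j else 0 := by
  have h1 := mul_divPow (d b k) (u (c j)) k (if b ≠ c j then Qnat k else 0) (H.comm_up _)
    (fun l => by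
      rw [H.down_mul_up]
      by_cases h : b ≠ c j <;> simp [h]) (p.curry j)
  have h2 := mul_divPow (d b k) (d (c j)) k 0 (H.comm_down _ _)
    (fun l => by simp [(H.comm_down b (c j) k l).eq]) (q.curry j)
  simp only [zero_smul, ite_self, add_zero] at h2
  rw [vertexOp, ← mul_assoc, h1, add_mul, mul_assoc, h2, ← mul_assoc]
  congr 1
  rw [vertexOp, curry_sub_single_self, Finsupp.curry_apply]
  by_cases hb : b ≠ c j <;> by_cases hp : 0 < p (j, k) <;> simp [hb, hp]

theorem IsWickSystem.down_mul_vertexProd (H : IsWickSystem u d vac ev) (b : Bool) (k : ℕ)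
    (p q : V × ℕ →₀ ℕ) (l : List V) (hl : l.Nodup) :
    d b k * vertexProd u d c l p q = vertexProd u d c l p q * d b k
      + (l.map fun j => if b ≠ c j ∧ 0 < p (j, k)
          then Qnat k • vertexProd u d c l (p - Finsupp.single (j, k) 1) q else 0).sum := by
  induction l with
  | nil => simp [vertexProd]
  | cons h t ih =>
    rw [List.nodup_cons] at hl
    rw [vertexProd_cons, ← mul_assoc, H.down_mul_vertexOp, add_mul, mul_assoc, ih hl.2, mul_add,
      ← mul_assoc, add_assoc, List.map_cons, List.sum_cons]
    congr 1
    rw [add_comm]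
    congr 1
    · rw [vertexProd_cons, vertexProd_sub_single hl.1, ite_mul, zero_mul, smul_mul_assoc]
    · rw [← List.sum_map_mul_left]
      congr 1
      refine List.map_congr_left fun j hj => ?_
      have hjh : j ≠ h := fun e => hl.1 (e ▸ hj)
      rw [vertexProd_cons, mul_ite, mul_zero, mul_smul_comm]
      simp only [vertexOp, curry_sub_single_ne _ hjh]

theorem IsWickSystem.vertexProd_raise [LinearOrder V] (H : IsWickSystem u d vac ev) (i : V) (k : ℕ)
    (p q : V × ℕ →₀ ℕ) (l : List V) (hl : l.Pairwise (· < ·)) (hi : i ∈ l) :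
    ((q (i, k) + 1 : ℕ) : RR) • vertexProd u d c l p (q + Finsupp.single (i, k) 1) vac
      = (l.map fun j => if i < j ∧ c i ≠ c j ∧ 0 < p (j, k)
          then Qnat k • vertexProd u d c l (p - Finsupp.single (j, k) 1) q vac else 0).sum := by
  induction l with
  | nil => simp at hi
  | cons h t ih =>
    rw [List.pairwise_cons] at hl
    have hht : h ∉ t := fun hh => lt_irrefl _ (hl.1 h hh)
    rw [List.map_cons, List.sum_cons]
    by_cases hih : i = h
    · subst hih
      have h1 := divPow_add_single (d (c i)) (H.comm_down _ _) (q.curry i) k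
      rw [Finsupp.curry_apply] at h1
      rw [vertexProd_cons, vertexProd_add_single hht, vertexOp, curry_add_single_self,
        ← LinearMap.smul_apply, ← smul_mul_assoc, ← mul_smul_comm, h1, ← mul_assoc, mul_assoc,
        H.down_mul_vertexProd _ _ _ _ _ (hl.2.imp ne_of_lt), Module.End.mul_apply,
        LinearMap.add_apply, Module.End.mul_apply (vertexProd _ _ _ _ _ _), H.down_vac, map_zero,
        zero_add, if_neg (fun h => lt_irrefl _ h.1), zero_add]
      rw [← vertexOp, ← Module.End.mul_apply, ← List.sum_map_mul_left,
        ← LinearMap.applyₗ_apply_apply (R := RR), map_list_sum, List.map_map]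
      congr 1
      refine List.map_congr_left fun j hj => ?_
      have hjh : j ≠ i := fun e => hht (e ▸ hj)
      rw [Function.comp_apply, vertexProd_cons]
      by_cases hc : c i ≠ c j ∧ 0 < p (j, k)
      · rw [if_pos hc, if_pos ⟨hl.1 j hj, hc⟩]
        simp [vertexOp, curry_sub_single_ne _ hjh]
      · rw [if_neg hc, if_neg fun h => hc h.2]
        simp
    · have hit : i ∈ t := (List.mem_cons.1 hi).resolve_left hih
      rw [if_neg (fun hh => lt_asymm (hl.1 i hit) hh.1), zero_add, vertexProd_cons,
        Module.End.mul_apply, ← map_smul, ih hl.2 hit, map_list_sum, List.map_map, vertexOp,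
        curry_add_single_ne _ hih]
      congr 1
      refine List.map_congr_left fun j hj => ?_
      have hjh : j ≠ h := fun e => hht (e ▸ hj)
      rw [Function.comp_apply, vertexProd_cons]
      by_cases hc : i < j ∧ c i ≠ c j ∧ 0 < p (j, k)
      · rw [if_pos hc, if_pos hc]
        simp [vertexOp, curry_sub_single_ne _ hjh]
      · rw [if_neg hc, if_neg hc]
        simp

theorem IsWickSystem.ev_divPow (H : IsWickSystem u d vac ev) (b : Bool) (μ : ℕ →₀ ℕ) (hμ : μ ≠ 0)
    (x : F) : ev (divPow (u b) μ x) = 0 := by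
  obtain ⟨k, hk⟩ := Finsupp.ne_iff.1 hμ
  have hk' : 0 < μ k := Nat.pos_of_ne_zero hk
  have hsub : μ - Finsupp.single k 1 + Finsupp.single k 1 = μ :=
    tsub_add_cancel_of_le (Finsupp.single_le_iff.2 hk')
  have h := divPow_add_single (u b) (H.comm_up b) (μ - Finsupp.single k 1) k
  have h2 := mul_divPow (u b k) (u b) k 0 (H.comm_up _)
    (fun l => by simp [(H.comm_up b k l).eq]) (μ - Finsupp.single k 1)
  simp only [zero_smul, ite_self, add_zero] at h2
  rw [hsub, ← h2] at h
  apply natCast_smul_cancel ((μ - Finsupp.single k 1 : ℕ →₀ ℕ) k)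
  rw [← map_smul, ← LinearMap.smul_apply, h, Module.End.mul_apply, H.ev_up, smul_zero]

theorem IsWickSystem.ev_vertexProd_zero (H : IsWickSystem u d vac ev) (p : V × ℕ →₀ ℕ)
    (l : List V) :
    ev (vertexProd u d c l p 0 vac) = if ∀ j ∈ l, p.curry j = 0 then 1 else 0 := by
  induction l with
  | nil => simp [vertexProd, H.ev_vac]
  | cons h t ih =>
    have h0 : (0 : V × ℕ →₀ ℕ).curry h = 0 := by ext; simp
    rw [vertexProd_cons, vertexOp, h0, divPow_zero, mul_one, Module.End.mul_apply]
    by_cases hp : p.curry h = 0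
    · rw [hp, divPow_zero, Module.End.one_apply, ih]
      simp [hp]
    · rw [H.ev_divPow _ _ hp, if_neg]
      intro hh
      exact hp (hh h List.mem_cons_self)

end Wick

section Diagrams

variable {V : Type*}

/-- The port (vertex and weight) at which an edge `(i, j, k)` starts. -/
def edgeSrc (t : V × V × ℕ) : V × ℕ := (t.1, t.2.2)

/-- The port (vertex and weight) at which an edge `(i, j, k)` ends. -/
def edgeTgt (t : V × V × ℕ) : V × ℕ := (t.2.1, t.2.2)

/-- Edge multiplicity functions with prescribed outgoing and incoming degrees. -/
def diagrams (q p : V × ℕ →₀ ℕ) : Set (V × V × ℕ →₀ ℕ) :=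
  {g | g.mapDomain edgeSrc = q ∧ g.mapDomain edgeTgt = p}

/-- The weight `∏_t wt(t)^{g(t)} / g(t)!` of an edge multiplicity function. -/
noncomputable def diagWeight (wt : V × V × ℕ → RR) (g : V × V × ℕ →₀ ℕ) : RR :=
  g.prod fun t m => LaurentPolynomial.C (m.factorial : ℚ)⁻¹ * wt t ^ m

theorem diagWeight_add_single (wt : V × V × ℕ → RR) (g : V × V × ℕ →₀ ℕ) (t : V × V × ℕ) :
    ((g t + 1 : ℕ) : RR) * diagWeight wt (g + Finsupp.single t 1) = wt t * diagWeight wt g := by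
  have h1 : diagWeight wt g = ∏ i ∈ insert t g.support,
      (LaurentPolynomial.C ((g i).factorial : ℚ)⁻¹ * wt i ^ g i) :=
    Finsupp.prod_of_support_subset _ (Finset.subset_insert _ _) _ (by simp)
  have h2 : diagWeight wt (g + Finsupp.single t 1) = ∏ i ∈ insert t g.support,
      (LaurentPolynomial.C (((g + Finsupp.single t 1 : V × V × ℕ →₀ ℕ) i).factorial : ℚ)⁻¹
        * wt i ^ (g + Finsupp.single t 1 : V × V × ℕ →₀ ℕ) i) := by
    refine Finsupp.prod_of_support_subset _ ?_ _ (by simp)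
    intro i hi
    by_cases h : i = t
    · simp [h]
    · have : ¬ t = i := fun h' => h h'.symm
      simpa [h, this, Finsupp.single_apply] using hi
  have ht : t ∈ insert t g.support := Finset.mem_insert_self _ _
  rw [h1, h2, ← Finset.mul_prod_erase _ _ ht, ← Finset.mul_prod_erase _ _ ht, ← mul_assoc,
    ← mul_assoc (wt t)]
  congr 1
  · have hc : ((g t + 1 : ℕ) : RR) * LaurentPolynomial.C ((g t + 1).factorial : ℚ)⁻¹
        = LaurentPolynomial.C ((g t).factorial : ℚ)⁻¹ := by
      rw [← map_natCast (LaurentPolynomial.C (R := ℚ)), ← map_mul, Nat.factorial_succ,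
        Nat.cast_mul, mul_inv, mul_inv_cancel_left₀ (by positivity)]
    rw [Finsupp.add_apply, Finsupp.single_eq_same, ← mul_assoc, hc, pow_succ]
    ring
  · refine Finset.prod_congr rfl fun i hi => ?_
    have : ¬ t = i := fun h' => (Finset.ne_of_mem_erase hi) h'.symm
    simp [this]

theorem mapDomain_edgeSrc_apply [Fintype V] (g : V × V × ℕ →₀ ℕ) (i : V) (k : ℕ) :
    g.mapDomain edgeSrc (i, k) = ∑ j, g (i, j, k) := by
  induction g using Finsupp.induction_linear with
  | zero => simp
  | add f g hf hg => simp [Finsupp.mapDomain_add, hf, hg, Finset.sum_add_distrib]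
  | single t m =>
    obtain ⟨i', j', k'⟩ := t
    simp only [Finsupp.mapDomain_single, edgeSrc, Finsupp.single_apply, Prod.mk.injEq]
    by_cases h1 : i' = i <;> by_cases h2 : k' = k <;> simp [h1, h2]

theorem mapDomain_edgeTgt_apply [Fintype V] (g : V × V × ℕ →₀ ℕ) (j : V) (k : ℕ) :
    g.mapDomain edgeTgt (j, k) = ∑ i, g (i, j, k) := by
  induction g using Finsupp.induction_linear with
  | zero => simp
  | add f g hf hg => simp [Finsupp.mapDomain_add, hf, hg, Finset.sum_add_distrib]
  | single t m =>
    obtain ⟨i', j', k'⟩ := t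
    simp only [Finsupp.mapDomain_single, edgeTgt, Finsupp.single_apply, Prod.mk.injEq]
    by_cases h1 : j' = j <;> by_cases h2 : k' = k <;> simp [h1, h2]

variable [Fintype V]

theorem le_mapDomain_edgeSrc (g : V × V × ℕ →₀ ℕ) (i j : V) (k : ℕ) :
    g (i, j, k) ≤ g.mapDomain edgeSrc (i, k) := by
  rw [mapDomain_edgeSrc_apply]
  exact Finset.single_le_sum (f := fun j => g (i, j, k)) (fun _ _ => Nat.zero_le _) (mem_univ j)

theorem le_mapDomain_edgeTgt (g : V × V × ℕ →₀ ℕ) (i j : V) (k : ℕ) :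
    g (i, j, k) ≤ g.mapDomain edgeTgt (j, k) := by
  rw [mapDomain_edgeTgt_apply]
  exact Finset.single_le_sum (f := fun i => g (i, j, k)) (fun _ _ => Nat.zero_le _) (mem_univ i)

theorem finite_diagrams (q p : V × ℕ →₀ ℕ) : (diagrams q p).Finite := by
  let A : Finset (V × V × ℕ) :=
    (q.support ×ˢ p.support).image fun s => (s.1.1, s.2.1, s.1.2)
  refine (Finset.finite_toSet (A.finsupp fun t => Finset.range (q (edgeSrc t) + 1))).subset ?_
  rintro g ⟨hq, hp⟩
  rw [Finset.mem_coe, Finset.mem_finsupp_iff]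
  constructor
  · rintro ⟨i, j, k⟩ ht
    have h0 : 0 < g (i, j, k) := Nat.pos_of_ne_zero (Finsupp.mem_support_iff.1 ht)
    have h1 := le_mapDomain_edgeSrc g i j k
    have h2 := le_mapDomain_edgeTgt g i j k
    rw [hq] at h1
    rw [hp] at h2
    refine Finset.mem_image.2 ⟨((i, k), (j, k)), ?_, rfl⟩
    rw [Finset.mem_product, Finsupp.mem_support_iff, Finsupp.mem_support_iff]
    exact ⟨by dsimp only; omega, by dsimp only; omega⟩
  · rintro ⟨i, j, k⟩ -
    have h1 := le_mapDomain_edgeSrc g i j k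
    rw [hq] at h1
    exact Finset.mem_range.2 (Nat.lt_succ_of_le h1)

/-- The sum of the weights of all edge multiplicity functions of given degrees. -/
noncomputable def diagSum (wt : V × V × ℕ → RR) (q p : V × ℕ →₀ ℕ) : RR :=
  ∑ g ∈ (finite_diagrams q p).toFinset, diagWeight wt g

theorem diagSum_zero (wt : V × V × ℕ → RR) (p : V × ℕ →₀ ℕ) :
    diagSum wt 0 p = if p = 0 then 1 else 0 := by
  have h0 : ∀ g : V × V × ℕ →₀ ℕ, g.mapDomain edgeSrc = 0 → g = 0 := by
    intro g hg
    ext ⟨i, j, k⟩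
    have := le_mapDomain_edgeSrc g i j k
    rw [hg] at this
    simpa using this
  by_cases hp : p = 0
  · have : (finite_diagrams (0 : V × ℕ →₀ ℕ) p).toFinset = {0} := by
      ext g
      simp only [Set.Finite.mem_toFinset, diagrams, Set.mem_ofPred_eq, Finset.mem_singleton, hp]
      exact ⟨fun h => h0 g h.1, fun h => by simp [h]⟩
    rw [diagSum, this, if_pos hp]
    simp [diagWeight]
  · rw [diagSum, if_neg hp]
    refine Finset.sum_eq_zero fun g hg => absurd ?_ hp
    obtain ⟨h1, h2⟩ := (Set.Finite.mem_toFinset _).1 hg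
    rw [← h2, h0 g h1, Finsupp.mapDomain_zero]

theorem sum_diagrams_mul (wt : V × V × ℕ → RR) (q p : V × ℕ →₀ ℕ) (i j : V) (k : ℕ) :
    ∑ g ∈ (finite_diagrams (q + Finsupp.single (i, k) 1) p).toFinset,
        ((g (i, j, k) : ℕ) : RR) * diagWeight wt g
      = if 0 < p (j, k) then wt (i, j, k) * diagSum wt q (p - Finsupp.single (j, k) 1) else 0 := by
  by_cases hp : 0 < p (j, k)
  · have hsub : p - Finsupp.single (j, k) 1 + Finsupp.single (j, k) 1 = p :=
      tsub_add_cancel_of_le (Finsupp.single_le_iff.2 hp)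
    rw [if_pos hp, diagSum, Finset.mul_sum]
    symm
    refine Finset.sum_of_injOn (fun g => g + Finsupp.single (i, j, k) 1)
      (fun g _ g' _ h => add_right_cancel h) ?_ ?_ ?_
    · intro g hg
      obtain ⟨h1, h2⟩ := (Set.Finite.mem_toFinset _).1 (Finset.mem_coe.1 hg)
      refine Finset.mem_coe.2 ((Set.Finite.mem_toFinset _).2 ⟨?_, ?_⟩)
      · rw [Finsupp.mapDomain_add, h1, Finsupp.mapDomain_single, edgeSrc]
      · rw [Finsupp.mapDomain_add, h2, Finsupp.mapDomain_single, edgeTgt, hsub]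
    · intro g hg hng
      obtain ⟨h1, h2⟩ := (Set.Finite.mem_toFinset _).1 hg
      by_cases h : g (i, j, k) = 0
      · simp [h]
      · have hs : g - Finsupp.single (i, j, k) 1 + Finsupp.single (i, j, k) 1 = g :=
          tsub_add_cancel_of_le (Finsupp.single_le_iff.2 (Nat.pos_of_ne_zero h))
        rw [← hs, Finsupp.mapDomain_add, Finsupp.mapDomain_single] at h1 h2
        refine absurd ⟨g - Finsupp.single (i, j, k) 1, ?_, hs⟩ hng
        refine Finset.mem_coe.2 ((Set.Finite.mem_toFinset _).2 ⟨?_, ?_⟩)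
        · exact add_right_cancel h1
        · exact add_right_cancel (h2.trans hsub.symm)
    · intro g _
      rw [← diagWeight_add_single]
      simp
  · rw [if_neg hp]
    refine Finset.sum_eq_zero fun g hg => ?_
    obtain ⟨-, h2⟩ := (Set.Finite.mem_toFinset _).1 hg
    have := le_mapDomain_edgeTgt g i j k
    rw [h2] at this
    have h : g (i, j, k) = 0 := by omega
    simp [h]

theorem diagSum_add_single (wt : V × V × ℕ → RR) (q p : V × ℕ →₀ ℕ) (i : V) (k : ℕ) :
    ((q (i, k) + 1 : ℕ) : RR) * diagSum wt (q + Finsupp.single (i, k) 1) p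
      = ∑ j, if 0 < p (j, k)
          then wt (i, j, k) * diagSum wt q (p - Finsupp.single (j, k) 1) else 0 := by
  simp_rw [← sum_diagrams_mul]
  rw [Finset.sum_comm, diagSum, Finset.mul_sum]
  refine Finset.sum_congr rfl fun g hg => ?_
  obtain ⟨h1, -⟩ := (Set.Finite.mem_toFinset _).1 hg
  have h := mapDomain_edgeSrc_apply g i k
  rw [h1, Finsupp.add_apply, Finsupp.single_eq_same] at h
  rw [h, Nat.cast_sum, Finset.sum_mul]

/-- The recursion obtained by contracting one outgoing edge determines the diagram sum. -/
theorem eq_diagSum (wt : V × V × ℕ → RR) (E : (V × ℕ →₀ ℕ) → (V × ℕ →₀ ℕ) → RR)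
    (zero : ∀ p, E 0 p = if p = 0 then 1 else 0)
    (add_single : ∀ q p i k, ((q (i, k) + 1 : ℕ) : RR) * E (q + Finsupp.single (i, k) 1) p
      = ∑ j, if 0 < p (j, k) then wt (i, j, k) * E q (p - Finsupp.single (j, k) 1) else 0)
    (q p : V × ℕ →₀ ℕ) : E q p = diagSum wt q p := by
  induction q using partition_induction generalizing p with
  | zero => rw [zero, diagSum_zero]
  | add_single q s ih =>
    apply natCast_smul_cancel (q s)
    rw [smul_eq_mul, smul_eq_mul, add_single, diagSum_add_single]
    simp_rw [ih]

end Diagrams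

/-- Wick's theorem for products of normally ordered divided powers. -/
theorem IsWickSystem.ev_vertexProd {n : ℕ} {u d : Bool → ℕ → Module.End RR F} {c : Fin n → Bool}
    {vac : F} {ev : F →ₗ[RR] RR} (H : IsWickSystem u d vac ev) (q p : Fin n × ℕ →₀ ℕ) :
    ev (vertexProd u d c (List.finRange n) p q vac)
      = diagSum (fun t => if t.1 < t.2.1 ∧ c t.1 ≠ c t.2.1 then Qnat t.2.2 else 0) q p := by
  refine eq_diagSum _ (fun q p => ev (vertexProd u d c (List.finRange n) p q vac)) ?_ ?_ q p
  · intro p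
    rw [H.ev_vertexProd_zero]
    have hiff : (∀ j ∈ List.finRange n, p.curry j = 0) ↔ p = 0 := by
      refine ⟨fun h => ?_, fun h j _ => ?_⟩
      · ext ⟨j, k⟩
        simpa using DFunLike.congr_fun (h j (List.mem_finRange j)) k
      · ext k
        simp [h]
    by_cases hp : p = 0
    · rw [if_pos (hiff.2 hp), if_pos hp]
    · rw [if_neg fun h => hp (hiff.1 h), if_neg hp]
  · intro q p i k
    rw [← smul_eq_mul, ← map_smul,
      H.vertexProd_raise i k p q _ (List.pairwise_lt_finRange n) (List.mem_finRange i), map_list_sum,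
      List.map_map, Fin.sum_univ_def]
    congr 1
    refine List.map_congr_left fun j _ => ?_
    rw [Function.comp_apply]
    by_cases h1 : i < j <;> by_cases h2 : c i = c j <;> by_cases h3 : 0 < p (j, k) <;>
      simp [h1, h2, h3]

theorem qInt_natCast (n : ℕ) : qInt (n : ℤ) = Qnat n := by
  simp [qInt]

theorem qInt_neg_natCast (n : ℕ) : qInt (-(n : ℤ)) = -Qnat n := by
  rcases Nat.eq_zero_or_pos n with rfl | h
  · simp [qInt, Qnat]
  · have : ¬ (0 : ℤ) ≤ -(n : ℤ) := by omega
    simp [qInt, h.ne']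

/-- The incoming partition of a factor. -/
noncomputable def facIn : FacW → ℕ →₀ ℕ
  | .inl (μ, _) => μ
  | .inr (k, _) => Finsupp.single k 1

/-- The outgoing partition of a factor. -/
noncomputable def facOut : FacW → ℕ →₀ ℕ
  | .inl (_, ν) => ν
  | .inr (k, true) => Finsupp.single k 1
  | .inr (_, false) => 0

theorem facOut_zero {f : FacW} (hf : ValidFacW f) : facOut f 0 = 0 := by
  rcases f with ⟨μ, ν⟩ | ⟨k, _ | _⟩
  · exact hf.2
  · rfl
  · have : k ≠ 0 := Nat.pos_iff_ne_zero.1 hf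
    simp [facOut, this]

theorem facOut_le_one {f : FacW} (hf : f.isLeft = false) (k : ℕ) : facOut f k ≤ 1 := by
  rcases f with ⟨μ, ν⟩ | ⟨l, _ | _⟩
  · simp at hf
  · simp [facOut]
  · simp only [facOut, Finsupp.single_apply]
    split_ifs <;> simp

theorem facIn_le_one {f : FacW} (hf : f.isLeft = false) (k : ℕ) : facIn f k ≤ 1 := by
  rcases f with ⟨μ, ν⟩ | ⟨l, _⟩
  · simp at hf
  · simp only [facIn, Finsupp.single_apply]
    split_ifs <;> simp

theorem isFeynman_iff (L : List FacW) (g : ℕ × ℕ × ℕ → ℕ) :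
    IsFeynman L g ↔
      (∀ i j k, g (i, j, k) ≠ 0 →
        i < j ∧ j < L.length ∧ 0 < k ∧ (facAt L i).isLeft ≠ (facAt L j).isLeft) ∧
      ∀ i < L.length, ∀ k, outDeg L g i k = facOut (facAt L i) k ∧
        inDeg L g i k = facIn (facAt L i) k := by
  refine and_congr_right fun _ => ⟨?_, ?_⟩
  · rintro ⟨h1, h2, h3⟩ i hi k
    rcases h : facAt L i with ⟨μ, ν⟩ | ⟨l, _ | _⟩
    · exact h1 i hi μ ν h k
    · simpa [facOut, facIn, Finsupp.single_apply, eq_comm] using h3 i hi l h k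
    · simpa [facOut, facIn, Finsupp.single_apply, eq_comm] using h2 i hi l h k
  · intro H
    refine ⟨fun i hi μ ν h k => ?_, fun i hi l h k => ?_, fun i hi l h k => ?_⟩
    · simpa [h, facOut, facIn] using H i hi k
    · simpa [h, facOut, facIn, Finsupp.single_apply, eq_comm] using H i hi k
    · simpa [h, facOut, facIn, Finsupp.single_apply, eq_comm] using H i hi k

theorem toOpW_eq (a b : ℤ → Module.End RR F)
    (hbb : ∀ n m : ℤ, b n * b m = b m * b n) (f : FacW) :
    toOpW a b f = divPow (fun k : ℕ => (if f.isLeft then a else b) (-(k : ℤ))) (facIn f)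
      * divPow (fun k : ℕ => (if f.isLeft then a else b) (k : ℤ)) (facOut f) := by
  rcases f with ⟨μ, ν⟩ | ⟨k, _ | _⟩
  · simp [toOpW, facIn, facOut, aNegF, aPosF, divPow]
  · change b (-(k : ℤ)) = divPow (fun k : ℕ => b (-(k : ℤ))) (Finsupp.single k 1)
      * divPow (fun k : ℕ => b (k : ℤ)) 0
    rw [divPow_single_one _ fun _ _ => hbb _ _, divPow_zero, mul_one]
  · change b (-(k : ℤ)) * b (k : ℤ) = divPow (fun k : ℕ => b (-(k : ℤ))) (Finsupp.single k 1)
      * divPow (fun k : ℕ => b (k : ℤ)) (Finsupp.single k 1)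
    rw [divPow_single_one _ fun _ _ => hbb _ _, divPow_single_one _ fun _ _ => hbb _ _]

theorem isWickSystem_of_heisenberg
    (a b : ℤ → Module.End RR F) (vac : F) (B : F →ₗ[RR] F →ₗ[RR] RR)
    (haa : ∀ n m : ℤ, a n * a m = a m * a n)
    (hbb : ∀ n m : ℤ, b n * b m = b m * b n)
    (hab : ∀ n m : ℤ, a n * b m - b m * a n
        = if n = -m then qInt n • (1 : Module.End RR F) else 0)
    (ha0 : a 0 = 0) (hb0 : b 0 = 0)
    (havac : ∀ n : ℤ, 0 < n → a n vac = 0)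
    (hbvac : ∀ n : ℤ, 0 < n → b n vac = 0)
    (hBvac : B vac vac = 1)
    (hBa : ∀ (n : ℤ) (x y : F), B (a n x) y = B x (a (-n) y))
    (hBb : ∀ (n : ℤ) (x y : F), B (b n x) y = B x (b (-n) y)) :
    IsWickSystem (fun c k => (if c then a else b) (-(k : ℤ)))
      (fun c k => (if c then a else b) (k : ℤ)) vac (B vac) := by
  have hcomm : ∀ k l : ℕ, a k * b l = b l * a k := by
    intro k l
    rcases Nat.eq_zero_or_pos k with rfl | hk
    · simp [ha0]
    · have h := hab k l
      rwa [if_neg (by omega), sub_eq_zero] at h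
  have hvac : ∀ (c : Bool) (k : ℕ), (if c then a else b) (k : ℤ) vac = 0 := by
    intro c k
    rcases Nat.eq_zero_or_pos k with rfl | hk
    · cases c <;> simp [ha0, hb0]
    · cases c
      · simpa using hbvac k (by exact_mod_cast hk)
      · simpa using havac k (by exact_mod_cast hk)
  refine ⟨?_, ?_, ?_, hvac, ?_, hBvac⟩
  · rintro (_ | _) k l
    · exact hbb _ _
    · exact haa _ _
  · rintro (_ | _) (_ | _) k l
    · exact hbb _ _
    · exact (hcomm l k).symm
    · exact hcomm k l
    · exact haa _ _
  · rintro (_ | _) (_ | _) k l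
    · simpa using hbb _ _
    · have h := hab (-(l : ℤ)) k
      rw [sub_eq_iff_eq_add] at h
      by_cases hkl : k = l
      · subst hkl
        simp [h, qInt_neg_natCast]
      · have : ¬ l = k := fun e => hkl e.symm
        simp [h, hkl, this]
    · have h := hab k (-(l : ℤ))
      rw [sub_eq_iff_eq_add] at h
      simp [h, qInt_natCast, add_comm]
    · simpa using haa _ _
  · intro c k x
    have h := hvac c k
    cases c
    · have h' := hBb k vac x
      simp only [Bool.false_eq_true, if_false] at h ⊢
      rw [← h', h, map_zero, LinearMap.zero_apply]
    · have h' := hBa k vac x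
      simp only [if_true] at h ⊢
      rw [← h', h, map_zero, LinearMap.zero_apply]

section Feynman

/-- Forget that the end points of edges are bounded by `n`. -/
def edgeVal (n : ℕ) (t : Fin n × Fin n × ℕ) : ℕ × ℕ × ℕ := (t.1, t.2.1, t.2.2)

theorem edgeVal_injective (n : ℕ) : Function.Injective (edgeVal n) := by
  rintro ⟨i, j, k⟩ ⟨i', j', k'⟩ h
  simpa [edgeVal, Fin.val_inj] using h

theorem mapDomain_edgeVal_apply {n : ℕ} (g : Fin n × Fin n × ℕ →₀ ℕ) (i j : Fin n) (k : ℕ) :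
    g.mapDomain (edgeVal n) (i, j, k) = g (i, j, k) :=
  Finsupp.mapDomain_apply (edgeVal_injective n) g (i, j, k)

variable (L : List FacW)

/-- The total partition data of a word. -/
noncomputable def ports (f : FacW → ℕ →₀ ℕ) : Fin L.length × ℕ →₀ ℕ :=
  (Finsupp.equivFunOnFinite.symm fun i => f (L.get i)).uncurry

theorem ports_curry (f : FacW → ℕ →₀ ℕ) (i : Fin L.length) :
    (ports L f).curry i = f (L.get i) := by
  simp [ports]

theorem ports_apply (f : FacW → ℕ →₀ ℕ) (i : Fin L.length) (k : ℕ) :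
    ports L f (i, k) = f (L.get i) k := by
  rw [← ports_curry L f, Finsupp.curry_apply]

theorem facAt_fin (i : Fin L.length) : facAt L i = L.get i := by
  simp [facAt]

theorem degrees_iff (g : Fin L.length × Fin L.length × ℕ →₀ ℕ) :
    g ∈ diagrams (ports L facOut) (ports L facIn) ↔
      ∀ i < L.length, ∀ k, outDeg L (g.mapDomain (edgeVal _)) i k = facOut (facAt L i) k ∧
        inDeg L (g.mapDomain (edgeVal _)) i k = facIn (facAt L i) k := by
  have ho : ∀ (i : Fin L.length) k,
      outDeg L (g.mapDomain (edgeVal _)) i k = g.mapDomain edgeSrc (i, k) := by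
    intro i k
    rw [outDeg, Finset.sum_range, mapDomain_edgeSrc_apply]
    simp_rw [mapDomain_edgeVal_apply]
  have hi : ∀ (i : Fin L.length) k,
      inDeg L (g.mapDomain (edgeVal _)) i k = g.mapDomain edgeTgt (i, k) := by
    intro i k
    rw [inDeg, Finset.sum_range, mapDomain_edgeTgt_apply]
    simp_rw [mapDomain_edgeVal_apply]
  constructor
  · rintro ⟨h1, h2⟩ i hi' k
    have hf := facAt_fin L ⟨i, hi'⟩
    have e1 := ho ⟨i, hi'⟩ k
    have e2 := hi ⟨i, hi'⟩ k
    rw [h1, ports_apply, ← hf] at e1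
    rw [h2, ports_apply, ← hf] at e2
    exact ⟨e1, e2⟩
  · intro h
    constructor
    · ext ⟨i, k⟩
      rw [← ho, (h i i.2 k).1, ports_apply, facAt_fin]
    · ext ⟨i, k⟩
      rw [← hi, (h i i.2 k).2, ports_apply, facAt_fin]

/-- Every Feynman diagram comes from a finitely supported edge multiplicity function. -/
theorem exists_of_isFeynman {G : ℕ × ℕ × ℕ → ℕ} (hG : IsFeynman L G) :
    ∃ g ∈ diagrams (ports L facOut) (ports L facIn), ⇑(g.mapDomain (edgeVal L.length)) = G := by
  obtain ⟨h1, h2⟩ := (isFeynman_iff L G).1 hG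
  have hfin : (Function.support (G ∘ edgeVal L.length)).Finite := by
    let A : Finset (Fin L.length × Fin L.length × ℕ) :=
      univ ×ˢ univ ×ˢ (ports L facOut).support.image Prod.snd
    refine A.finite_toSet.subset ?_
    rintro ⟨i, j, k⟩ ht
    have h0 : G (i, j, k) ≠ 0 := ht
    have hle : G (i, j, k) ≤ outDeg L G i k :=
      Finset.single_le_sum (f := fun j => G (i, j, k)) (fun _ _ => Nat.zero_le _)
        (Finset.mem_range.2 j.2)
    rw [(h2 i i.2 k).1, facAt_fin, ← ports_apply] at hle
    have : ports L facOut (i, k) ≠ 0 := by omega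
    simp only [A, Finset.coe_product, Finset.coe_univ, Set.mem_prod, Set.mem_univ, true_and,
      Finset.mem_coe, Finset.mem_image]
    exact ⟨(i, k), Finsupp.mem_support_iff.2 this, rfl⟩
  have heq : ⇑((Finsupp.ofSupportFinite _ hfin).mapDomain (edgeVal L.length)) = G := by
    funext ⟨i, j, k⟩
    by_cases h : i < L.length ∧ j < L.length
    · exact mapDomain_edgeVal_apply _ ⟨i, h.1⟩ ⟨j, h.2⟩ k
    · rw [Finsupp.mapDomain_of_notMem_range]
      · by_contra h0
        obtain ⟨h3, h4, -⟩ := h1 i j k (fun e => h0 e.symm)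
        exact h ⟨h3.trans h4, h4⟩
      · rintro ⟨⟨i', j', k'⟩, ht⟩
        simp only [edgeVal, Prod.mk.injEq] at ht
        exact h ⟨ht.1 ▸ i'.2, ht.2.1 ▸ j'.2⟩
  refine ⟨_, ?_, heq⟩
  rw [degrees_iff, heq]
  exact h2

theorem multW_mapDomain {n : ℕ} (g : Fin n × Fin n × ℕ →₀ ℕ) :
    multW (g.mapDomain (edgeVal n)) = g.prod fun t m => Qnat t.2.2 ^ m := by
  rw [multW, finprod_eq_prod_of_mulSupport_subset (s := (g.mapDomain (edgeVal n)).support)]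
  · change (g.mapDomain (edgeVal n)).prod (fun t m => Qnat t.2.2 ^ m) = _
    rw [Finsupp.prod_mapDomain_index_inj (edgeVal_injective n)]
    rfl
  · intro t ht
    refine Finset.mem_coe.2 (Finsupp.mem_support_iff.2 fun h => ht ?_)
    simp [h]

theorem diagWeight_eq (hL : ∀ f ∈ L, ValidFacW f) {g : Fin L.length × Fin L.length × ℕ →₀ ℕ}
    (hg : g ∈ diagrams (ports L facOut) (ports L facIn)) :
    diagWeight (fun t => if t.1 < t.2.1 ∧ (L.get t.1).isLeft ≠ (L.get t.2.1).isLeft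
        then Qnat t.2.2 else 0) g
      = if IsFeynman L (g.mapDomain (edgeVal L.length))
        then multW (g.mapDomain (edgeVal L.length)) else 0 := by
  by_cases hF : ∀ t, g t ≠ 0 → t.1 < t.2.1 ∧ (L.get t.1).isLeft ≠ (L.get t.2.1).isLeft
  · rw [if_pos, multW_mapDomain, diagWeight]
    · refine Finset.prod_congr rfl fun t ht => ?_
      obtain ⟨i, j, k⟩ := t
      have h0 := Finsupp.mem_support_iff.1 ht
      have hc := hF _ h0
      have hle : g (i, j, k) ≤ 1 := by
        cases hi : (L.get i).isLeft with
        | false =>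
          refine (le_mapDomain_edgeSrc g i j k).trans ?_
          rw [hg.1, ports_apply]
          exact facOut_le_one hi k
        | true =>
          have hj : (L.get j).isLeft = false := by
            have := hc.2
            simp only [hi] at this
            simpa using this.symm
          refine (le_mapDomain_edgeTgt g i j k).trans ?_
          rw [hg.2, ports_apply]
          exact facIn_le_one hj k
      have h1 : g (i, j, k) = 1 := by omega
      dsimp only at hc ⊢
      rw [if_pos hc, h1]
      simp
    · refine (isFeynman_iff L _).2 ⟨?_, (degrees_iff L g).1 hg⟩
      intro i j k h
      have hr : (i, j, k) ∈ Set.range (edgeVal L.length) := by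
        by_contra hn
        exact h (Finsupp.mapDomain_of_notMem_range _ _ hn)
      obtain ⟨⟨i, j, k⟩, he⟩ := hr
      simp only [edgeVal, Prod.mk.injEq] at he
      obtain ⟨rfl, rfl, rfl⟩ := he
      rw [mapDomain_edgeVal_apply] at h
      obtain ⟨h1, h2⟩ := hF _ h
      refine ⟨h1, j.2, Nat.pos_of_ne_zero ?_, by rwa [facAt_fin, facAt_fin]⟩
      rintro rfl
      have hle := le_mapDomain_edgeSrc g i j 0
      rw [hg.1, ports_apply, facOut_zero (hL _ (List.get_mem L i))] at hle
      omega
  · push Not at hF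
    obtain ⟨⟨i, j, k⟩, h0, hn⟩ := hF
    rw [if_neg, diagWeight]
    · refine Finset.prod_eq_zero (Finsupp.mem_support_iff.2 h0) ?_
      dsimp only at hn ⊢
      rw [if_neg fun h => h.2 (hn h.1), zero_pow h0, mul_zero]
    · intro hF
      obtain ⟨h1, -, -, h2⟩ := hF.1 i j k (by rwa [mapDomain_edgeVal_apply])
      rw [facAt_fin, facAt_fin] at h2
      exact h2 (hn h1)

theorem finsum_isFeynman (hL : ∀ f ∈ L, ValidFacW f) :
    ∑ᶠ g : ℕ × ℕ × ℕ → ℕ, (if IsFeynman L g then multW g else 0)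
      = diagSum (fun t => if t.1 < t.2.1 ∧ (L.get t.1).isLeft ≠ (L.get t.2.1).isLeft
          then Qnat t.2.2 else 0) (ports L facOut) (ports L facIn) := by
  rw [finsum_eq_sum_of_support_subset (s := (finite_diagrams (ports L facOut)
    (ports L facIn)).toFinset.image
      fun g : Fin L.length × Fin L.length × ℕ →₀ ℕ => ⇑(g.mapDomain (edgeVal L.length)))]
  · rw [Finset.sum_image, diagSum]
    · refine Finset.sum_congr rfl fun g hg => ?_
      rw [diagWeight_eq L hL ((Set.Finite.mem_toFinset _).1 hg)]
    · intro g _ g' _ h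
      exact Finsupp.mapDomain_injective (edgeVal_injective _) (DFunLike.coe_injective h)
  · intro G hG
    have hF : IsFeynman L G := by
      by_contra h
      exact hG (if_neg h)
    obtain ⟨g, hg, rfl⟩ := exists_of_isFeynman L hF
    exact Finset.mem_coe.2 (Finset.mem_image.2 ⟨g, (Set.Finite.mem_toFinset _).2 hg, rfl⟩)

end Feynman

/- Statement 18 (Wick's theorem for Heisenberg monomials): if M = m_1 ⋯ m_l is
a monomial with factors of the form a_{-μ}a_ν, b_{-k}b_k, or b_{-k}, then
⟨M⟩ = ∑_{[Γ]} mult(Γ,y), the sum over equivalence classes of Feynman diagrams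
for M. -/
theorem stmt_18
    (a b : ℤ → Module.End RR F) (vac : F) (B : F →ₗ[RR] F →ₗ[RR] RR)
    (haa : ∀ n m : ℤ, a n * a m = a m * a n)
    (hbb : ∀ n m : ℤ, b n * b m = b m * b n)
    (hab : ∀ n m : ℤ, a n * b m - b m * a n
        = if n = -m then qInt n • (1 : Module.End RR F) else 0)
    (ha0 : a 0 = 0) (hb0 : b 0 = 0)
    (havac : ∀ n : ℤ, 0 < n → a n vac = 0)
    (hbvac : ∀ n : ℤ, 0 < n → b n vac = 0)
    (hBvac : B vac vac = 1)
    (hBa : ∀ (n : ℤ) (x y : F), B (a n x) y = B x (a (-n) y))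
    (hBb : ∀ (n : ℤ) (x y : F), B (b n x) y = B x (b (-n) y))
    (L : List FacW) (hL : ∀ f ∈ L, ValidFacW f) :
    B vac (((L.map (toOpW a b)).prod) vac)
      = ∑ᶠ g : ℕ × ℕ × ℕ → ℕ, if IsFeynman L g then multW g else 0 := by
  have H := isWickSystem_of_heisenberg a b vac B haa hbb hab ha0 hb0 havac hbvac hBvac hBa hBb
  rw [finsum_isFeynman L hL,
    ← H.ev_vertexProd (c := fun i => (L.get i).isLeft) (ports L facOut) (ports L facIn), vertexProd]
  congr 3
  conv_lhs => rw [← List.map_get_finRange L, List.map_map]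
  refine List.map_congr_left fun i _ => ?_
  rw [Function.comp_apply, toOpW_eq a b hbb, vertexOp, ports_curry, ports_curry]
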